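/- Let K be a field of characteristic 0. The K-vector space [𝔭_K(5,11,18)^{(7)}]_{220} is one-dimensional, and it is spanned by an irreducible polynomial g1 in which the coefficient of x^{44} is nonzero. Since 220/7 < √(5·11·18), this g1 is a negative curve for 𝔭_K(5,11,18). -/

import Mathlib

open MvPolynomial

noncomputable section

/-- The weight function assigning degrees `a, b, c` to the variables `x, y, z`. -/
def wt (a b c : ℕ) : Fin 3 → ℕ := ![a, b, c]

/-- The `K`-algebra map `K[x,y,z] → K[T]`, `x ↦ T^a`, `y ↦ T^b`, `z ↦ T^c`. -/
def toPoly (K : Type*) [CommRing K] (a b c : ℕ) :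
    MvPolynomial (Fin 3) K →ₐ[K] Polynomial K :=
  aeval ![Polynomial.X ^ a, Polynomial.X ^ b, Polynomial.X ^ c]

/-- The space monomial prime `𝔭_K(a,b,c)`. -/
def pIdeal (K : Type*) [CommRing K] (a b c : ℕ) : Ideal (MvPolynomial (Fin 3) K) :=
  RingHom.ker (toPoly K a b c)

instance pIdeal_isPrime (K : Type*) [Field K] (a b c : ℕ) : (pIdeal K a b c).IsPrime :=
  RingHom.ker_isPrime _

/-- The `n`-th symbolic power `Q^{(n)} = Q^n A_Q ∩ A` of a prime ideal. -/
def symbPow {A : Type*} [CommRing A] (Q : Ideal A) [Q.IsPrime] (n : ℕ) : Ideal A :=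
  Ideal.comap (algebraMap A (Localization.AtPrime Q))
    (Ideal.map (algebraMap A (Localization.AtPrime Q)) (Q ^ n))

/-- The symbolic Rees algebra `A[Qt, Q^{(2)}t^2, …] ⊆ A[t]`. -/
def symbolicRees {A : Type*} [CommRing A] (Q : Ideal A) [Q.IsPrime] :
    Subalgebra A (Polynomial A) :=
  Algebra.adjoin A
    (⋃ n : ℕ, (fun p => Polynomial.C p * Polynomial.X ^ n) '' ((symbPow Q n : Ideal A) : Set A))

/-- The degree-`d` homogeneous component `[J]_d` of an ideal `J ⊆ K[x,y,z]`,
as a `K`-subspace. -/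
def gpiece (K : Type*) [CommRing K] (a b c : ℕ) (J : Ideal (MvPolynomial (Fin 3) K))
    (d : ℕ) : Submodule K (MvPolynomial (Fin 3) K) :=
  (Submodule.restrictScalars K J) ⊓ (weightedHomogeneousSubmodule K (wt a b c) d)

end

/-- The lattice points parametrising the monomials of weighted degree `220`:
`(m, n)` stands for `x ^ 44 * (z ^ 2 / (x ^ 5 * y)) ^ m * (y ^ 3 / (x ^ 3 * z)) ^ n`. -/
def latticePoints : Finset (ℕ × ℕ) :=
  (Finset.range 8 ×ˢ Finset.range 9).filter fun p =>
    5 * p.1 + 3 * p.2 ≤ 44 ∧ p.1 ≤ 3 * p.2 ∧ p.2 ≤ 2 * p.1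

/-- The exponent vector of the monomial attached to a lattice point. -/
noncomputable def latticeExp (p : ℕ × ℕ) : Fin 3 →₀ ℕ :=
  Finsupp.equivFunOnFinite.symm ![44 - 5 * p.1 - 3 * p.2, 3 * p.2 - p.1, 2 * p.1 - p.2]

/-- The polynomial of weighted degree `220` with prescribed coefficients. -/
noncomputable def latticePoly {K : Type*} [CommRing K] (c : ℕ × ℕ → K) :
    MvPolynomial (Fin 3) K :=
  ∑ p ∈ latticePoints, monomial (latticeExp p) (c p)

lemma mem_latticePoints {p : ℕ × ℕ} :
    p ∈ latticePoints ↔ 5 * p.1 + 3 * p.2 ≤ 44 ∧ p.1 ≤ 3 * p.2 ∧ p.2 ≤ 2 * p.1 := by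
  simp only [latticePoints, Finset.mem_filter, Finset.mem_product, Finset.mem_range]
  omega

lemma weight_wt (d : Fin 3 →₀ ℕ) :
    Finsupp.weight (wt 5 11 18) d = 5 * d 0 + 11 * d 1 + 18 * d 2 := by
  simp [Finsupp.weight_apply, Finsupp.sum_fintype, Fin.sum_univ_three, wt, mul_comm]

lemma latticeExp_injOn : Set.InjOn latticeExp latticePoints := by
  intro p hp q hq h
  have hp := mem_latticePoints.1 hp
  have hq := mem_latticePoints.1 hq
  have h1 := DFunLike.congr_fun h 1
  have h2 := DFunLike.congr_fun h 2
  simp only [latticeExp, Finsupp.equivFunOnFinite_symm_apply_apply, Matrix.cons_val] at h1 h2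
  ext <;> omega

lemma weight_latticeExp {p : ℕ × ℕ} (hp : p ∈ latticePoints) :
    Finsupp.weight (wt 5 11 18) (latticeExp p) = 220 := by
  rw [mem_latticePoints] at hp
  rw [weight_wt]
  simp only [latticeExp, Finsupp.equivFunOnFinite_symm_apply_apply, Matrix.cons_val]
  omega

lemma exists_latticeExp_eq {d : Fin 3 →₀ ℕ} (hd : Finsupp.weight (wt 5 11 18) d = 220) :
    ∃ p ∈ latticePoints, latticeExp p = d := by
  rw [weight_wt] at hd
  refine ⟨((d 1 + 3 * d 2) / 5, (2 * d 1 + d 2) / 5), ?_, ?_⟩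
  · rw [mem_latticePoints]
    omega
  · ext i
    fin_cases i <;>
      simp only [latticeExp, Finsupp.equivFunOnFinite_symm_apply_apply, Matrix.cons_val,
        Fin.zero_eta, Fin.mk_one, Fin.reduceFinMk] <;> omega

section LatticePoly

variable {K : Type*} [Field K]

lemma latticePoly_isWeightedHomogeneous (c : ℕ × ℕ → K) :
    IsWeightedHomogeneous (wt 5 11 18) (latticePoly c) 220 :=
  IsWeightedHomogeneous.sum _ _ _ fun _ hp =>
    isWeightedHomogeneous_monomial _ _ _ (weight_latticeExp hp)

lemma coeff_latticePoly (c : ℕ × ℕ → K) {p : ℕ × ℕ} (hp : p ∈ latticePoints) :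
    coeff (latticeExp p) (latticePoly c) = c p := by
  rw [latticePoly, coeff_sum, Finset.sum_eq_single p]
  · simp
  · intro q hq hqp
    rw [coeff_monomial, if_neg fun h => hqp (latticeExp_injOn hq hp h)]
  · exact fun h => absurd hp h

lemma eq_latticePoly {f : MvPolynomial (Fin 3) K}
    (hf : IsWeightedHomogeneous (wt 5 11 18) f 220) :
    f = latticePoly fun p => coeff (latticeExp p) f := by
  ext d
  by_cases hd : Finsupp.weight (wt 5 11 18) d = 220
  · obtain ⟨p, hp, rfl⟩ := exists_latticeExp_eq hd
    rw [coeff_latticePoly _ hp]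
  · rw [hf.coeff_eq_zero d hd, (latticePoly_isWeightedHomogeneous _).coeff_eq_zero d hd]

lemma aeval_latticePoly {A : Type*} [CommRing A] [Algebra K A] (v : Fin 3 → A) (c : ℕ × ℕ → K) :
    aeval v (latticePoly c) = ∑ p ∈ latticePoints, algebraMap K A (c p) *
      (v 0 ^ (44 - 5 * p.1 - 3 * p.2) * v 1 ^ (3 * p.2 - p.1) * v 2 ^ (2 * p.1 - p.2)) := by
  simp [latticePoly, aeval_monomial, latticeExp, Finsupp.prod_fintype, Fin.prod_univ_three]

end LatticePoly

section SymbolicPower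

lemma mem_symbPow {A : Type*} [CommRing A] {Q : Ideal A} [Q.IsPrime] {n : ℕ} {f : A} :
    f ∈ symbPow Q n ↔ ∃ s ∉ Q, s * f ∈ Q ^ n := by
  rw [symbPow, Ideal.mem_comap, IsLocalization.algebraMap_mem_map_algebraMap_iff Q.primeCompl]
  simp only [Ideal.mem_primeCompl_iff]

variable {K : Type*} [Field K]

/-- Vanishing to order `7` at `(1, 1)` of the Laurent polynomial with coefficients `c`. -/
def VanishesToOrderSeven (c : ℕ × ℕ → K) : Prop :=
  ∀ a b : ℕ, a + b < 7 → ∑ p ∈ latticePoints, c p * (p.1.choose a * p.2.choose b) = 0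

lemma clear_denominators {A : Type*} [CommRing A] (x y z r : A) {i j k m n m' n' : ℕ}
    (e0 : 15 + i = 5 * m' + 3 * n') (e1 : 7 + j = m' + 3 * n) (e2 : 8 + k = 2 * m + n') :
    x ^ 15 * y ^ 7 * z ^ 8 * (r * (x ^ i * y ^ j * z ^ k)) =
      r * (((z ^ 2) ^ m * (x ^ 5 * y) ^ m') * ((y ^ 3) ^ n * (x ^ 3 * z) ^ n')) := by
  calc x ^ 15 * y ^ 7 * z ^ 8 * (r * (x ^ i * y ^ j * z ^ k))
      = r * (x ^ (15 + i) * y ^ (7 + j) * z ^ (8 + k)) := by ring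
    _ = r * (((z ^ 2) ^ m * (x ^ 5 * y) ^ m') * ((y ^ 3) ^ n * (x ^ 3 * z) ^ n')) := by
        rw [e0, e1, e2]
        ring

lemma mul_latticePoly_expansion (c : ℕ × ℕ → K) :
    X 0 ^ 15 * X 1 ^ 7 * X 2 ^ 8 * latticePoly c =
      ∑ a ∈ Finset.range 8, ∑ b ∈ Finset.range 9,
        C (∑ p ∈ latticePoints, c p * (p.1.choose a * p.2.choose b)) *
          ((X 2 ^ 2 - X 0 ^ 5 * X 1) ^ a * (X 0 ^ 5 * X 1) ^ (7 - a) *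
            ((X 1 ^ 3 - X 0 ^ 3 * X 2) ^ b * (X 0 ^ 3 * X 2) ^ (8 - b))) := by
  have binom : ∀ (N m : ℕ), m ≤ N → ∀ u v : MvPolynomial (Fin 3) K,
      v ^ m * u ^ (N - m) =
        ∑ a ∈ Finset.range (N + 1), (m.choose a : MvPolynomial (Fin 3) K) *
          ((v - u) ^ a * u ^ (N - a)) := by
    intro N m hm u v
    have hsub : Finset.range (m + 1) ⊆ Finset.range (N + 1) :=
      Finset.range_subset_range.2 (by omega)
    rw [← Finset.sum_subset hsub]
    · conv_lhs => rw [← sub_add_cancel v u, add_pow, Finset.sum_mul]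
      refine Finset.sum_congr rfl fun a ha => ?_
      rw [Finset.mem_range] at ha
      rw [show N - a = (m - a) + (N - m) by omega, pow_add]
      ring
    · intro a _ ha
      rw [Finset.mem_range, not_lt] at ha
      simp [Nat.choose_eq_zero_of_lt (show m < a by omega)]
  have key : ∀ p ∈ latticePoints,
      X 0 ^ 15 * X 1 ^ 7 * X 2 ^ 8 * monomial (latticeExp p) (c p) =
        C (c p) * (((X 2 ^ 2) ^ p.1 * (X 0 ^ 5 * X 1) ^ (7 - p.1)) *
          ((X 1 ^ 3) ^ p.2 * (X 0 ^ 3 * X 2) ^ (8 - p.2))) := by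
    intro p hp
    rw [mem_latticePoints] at hp
    rw [monomial_eq, Finsupp.prod_fintype _ _ (by simp), Fin.prod_univ_three]
    simp only [latticeExp, Finsupp.equivFunOnFinite_symm_apply_apply, Matrix.cons_val]
    exact clear_denominators _ _ _ _ (by omega) (by omega) (by omega)
  rw [latticePoly, Finset.mul_sum, Finset.sum_congr rfl key]
  simp only [map_sum, Finset.sum_mul]
  rw [Finset.sum_congr rfl fun a _ => Finset.sum_comm, Finset.sum_comm]
  refine Finset.sum_congr rfl fun p hp => ?_
  have h7 : p.1 ≤ 7 ∧ p.2 ≤ 8 := by rw [mem_latticePoints] at hp; omega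
  rw [binom 7 p.1 h7.1, binom 8 p.2 h7.2, Finset.sum_mul_sum, Finset.mul_sum]
  refine Finset.sum_congr rfl fun a _ => ?_
  rw [Finset.mul_sum]
  refine Finset.sum_congr rfl fun b _ => ?_
  simp only [map_mul, map_natCast]
  ring

lemma latticePoly_mem_symbPow {c : ℕ × ℕ → K} (hc : VanishesToOrderSeven c) :
    latticePoly c ∈ symbPow (pIdeal K 5 11 18) 7 := by
  have hP : (X 2 ^ 2 - X 0 ^ 5 * X 1 : MvPolynomial (Fin 3) K) ∈ pIdeal K 5 11 18 := by
    rw [pIdeal, RingHom.mem_ker]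
    simp only [toPoly, map_sub, map_mul, map_pow, aeval_X, Matrix.cons_val]
    ring
  have hQ : (X 1 ^ 3 - X 0 ^ 3 * X 2 : MvPolynomial (Fin 3) K) ∈ pIdeal K 5 11 18 := by
    rw [pIdeal, RingHom.mem_ker]
    simp only [toPoly, map_sub, map_mul, map_pow, aeval_X, Matrix.cons_val]
    ring
  refine mem_symbPow.2 ⟨X 0 ^ 15 * X 1 ^ 7 * X 2 ^ 8, ?_, ?_⟩
  · rw [pIdeal, RingHom.mem_ker]
    simp [toPoly]
  · rw [mul_latticePoly_expansion]
    refine Ideal.sum_mem _ fun a _ => Ideal.sum_mem _ fun b _ => ?_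
    by_cases hab : a + b < 7
    · simp [hc a b hab]
    · refine Ideal.mul_mem_left _ _ (Ideal.pow_le_pow_right (not_lt.1 hab) ?_)
      rw [pow_add]
      exact Ideal.mul_mem_mul (Ideal.mul_mem_right _ _ (Ideal.pow_mem_pow hP a))
        (Ideal.mul_mem_right _ _ (Ideal.pow_mem_pow hQ b))

lemma X_pow_dvd_of_mem_symbPow {A D : Type*} [CommRing A] [CommRing D] [IsDomain D]
    {Q : Ideal A} [Q.IsPrime] (φ : A →+* Polynomial D) (hφ : ∀ f, Polynomial.X ∣ φ f ↔ f ∈ Q)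
    {f : A} {n : ℕ} (hf : f ∈ symbPow Q n) : Polynomial.X ^ n ∣ φ f := by
  obtain ⟨s, hs, hsf⟩ := mem_symbPow.1 hf
  have hle : Q ≤ (Ideal.span {(Polynomial.X : Polynomial D)}).comap φ := fun g hg => by
    rwa [Ideal.mem_comap, Ideal.mem_span_singleton, hφ]
  have hmem := (Ideal.pow_right_mono hle n).trans (Ideal.le_comap_pow _ n) hsf
  rw [Ideal.mem_comap, Ideal.span_singleton_pow, Ideal.mem_span_singleton, map_mul] at hmem
  exact Polynomial.prime_X.pow_dvd_of_dvd_mul_left n (mt (hφ s).1 hs) hmem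

section Deformation

variable {D : Type*} [CommRing D] [Algebra K D]

/-- A deformation of the point `(τ ^ 5, τ ^ 11, τ ^ 18)` scaling the monomials of weighted
degree `220` according to their lattice points. -/
noncomputable def deformation (τ σ : D) : MvPolynomial (Fin 3) K →ₐ[K] Polynomial D :=
  aeval ![.C τ ^ 5 * (1 + .X) ^ 4 * (1 + .C σ * .X) ^ 3,
    .C τ ^ 11 * (1 + .X) ^ 9 * (1 + .C σ * .X) ^ 7,
    .C τ ^ 18 * (1 + .X) ^ 15 * (1 + .C σ * .X) ^ 11]

lemma eval_zero_deformation (τ σ : D) (f : MvPolynomial (Fin 3) K) :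
    (deformation τ σ f).eval 0 = aeval ![τ ^ 5, τ ^ 11, τ ^ 18] f := by
  have h : ((Polynomial.aeval (0 : D)).restrictScalars K).comp (deformation τ σ) =
      aeval ![τ ^ 5, τ ^ 11, τ ^ 18] := by
    refine algHom_ext fun i => ?_
    fin_cases i <;> simp [deformation]
  simpa [Polynomial.coe_aeval_eq_eval] using DFunLike.congr_fun h f

lemma regroup_powers {A : Type*} [CommRing A] (t u v r : A) {i j k m n L M N : ℕ}
    (e0 : 5 * i + 11 * j + 18 * k = L) (e1 : 4 * i + 9 * j + 15 * k = M + m)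
    (e2 : 3 * i + 7 * j + 11 * k = N + n) :
    r * ((t ^ 5 * u ^ 4 * v ^ 3) ^ i * (t ^ 11 * u ^ 9 * v ^ 7) ^ j *
        (t ^ 18 * u ^ 15 * v ^ 11) ^ k) = t ^ L * u ^ M * v ^ N * (r * (u ^ m * v ^ n)) := by
  calc r * ((t ^ 5 * u ^ 4 * v ^ 3) ^ i * (t ^ 11 * u ^ 9 * v ^ 7) ^ j *
        (t ^ 18 * u ^ 15 * v ^ 11) ^ k)
      = r * (t ^ (5 * i + 11 * j + 18 * k) * u ^ (4 * i + 9 * j + 15 * k) *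
          v ^ (3 * i + 7 * j + 11 * k)) := by ring
    _ = t ^ L * u ^ M * v ^ N * (r * (u ^ m * v ^ n)) := by
        rw [e0, e1, e2]
        ring

lemma deformation_latticePoly (τ σ : D) (c : ℕ × ℕ → K) :
    ∃ L M N : ℕ, deformation τ σ (latticePoly c) =
      (.C τ ^ L * (1 + .X) ^ M * (1 + .C σ * .X) ^ N) *
        ∑ p ∈ latticePoints, .C (algebraMap K D (c p)) *
          ((1 + .X) ^ p.1 * (1 + .C σ * .X) ^ p.2) := by
  obtain ⟨L, hL⟩ : ∃ L, L = 220 := ⟨_, rfl⟩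
  obtain ⟨M, hM⟩ : ∃ M, M = 176 := ⟨_, rfl⟩
  obtain ⟨N, hN⟩ : ∃ N, N = 132 := ⟨_, rfl⟩
  refine ⟨L, M, N, ?_⟩
  rw [deformation, aeval_latticePoly, Finset.mul_sum]
  refine Finset.sum_congr rfl fun p hp => ?_
  rw [mem_latticePoints] at hp
  simp only [Matrix.cons_val, Polynomial.algebraMap_apply]
  exact regroup_powers _ _ _ _ (by omega) (by omega) (by omega)

lemma coeff_one_add_C_mul_X_pow (σ : D) (n b : ℕ) :
    ((1 + Polynomial.C σ * Polynomial.X) ^ n).coeff b = n.choose b * σ ^ b := by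
  have h : (1 + Polynomial.C σ * Polynomial.X) ^ n =
      ((1 + Polynomial.X) ^ n).comp (Polynomial.C σ * Polynomial.X) := by simp
  rw [h, Polynomial.comp_C_mul_X_coeff, Polynomial.coeff_one_add_X_pow]

lemma sum_choose_of_X_pow_dvd [IsDomain D] {τ σ : D} (hτ : τ ≠ 0) {c : ℕ × ℕ → K} {n r : ℕ}
    (hdvd : Polynomial.X ^ n ∣ deformation τ σ (latticePoly c)) (hr : r < n) :
    ∑ p ∈ latticePoints, algebraMap K D (c p) *
      ∑ q ∈ Finset.HasAntidiagonal.antidiagonal r,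
        ((p.1.choose q.1 : D) * (p.2.choose q.2 * σ ^ q.2)) = 0 := by
  obtain ⟨L, M, N, h⟩ := deformation_latticePoly τ σ c
  rw [h] at hdvd
  have hunit : ¬ Polynomial.X ∣
      (.C τ ^ L * (1 + .X) ^ M * (1 + .C σ * .X) ^ N : Polynomial D) := by
    have hX := Polynomial.prime_X (R := D)
    rw [hX.dvd_mul, hX.dvd_mul]
    rintro ((h | h) | h) <;> replace h := Polynomial.X_dvd_iff.1 (hX.dvd_of_dvd_pow h) <;>
      simp [hτ] at h
  have hcoeff := Polynomial.X_pow_dvd_iff.1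
    (Polynomial.prime_X.pow_dvd_of_dvd_mul_left n hunit hdvd) r hr
  simp_rw [Polynomial.finsetSum_coeff, Polynomial.coeff_C_mul, Polynomial.coeff_mul,
    Polynomial.coeff_one_add_X_pow, coeff_one_add_C_mul_X_pow] at hcoeff
  exact hcoeff

end Deformation

lemma X_dvd_deformation_iff {f : MvPolynomial (Fin 3) K} :
    Polynomial.X ∣ deformation (.C .X : Polynomial (Polynomial K)) .X f ↔
      f ∈ pIdeal K 5 11 18 := by
  have h : aeval ![(.C .X : Polynomial (Polynomial K)) ^ 5, .C .X ^ 11, .C .X ^ 18] =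
      ((Polynomial.CAlgHom (R := Polynomial K)).restrictScalars K).comp (toPoly K 5 11 18) := by
    refine algHom_ext fun i => ?_
    fin_cases i <;> simp [toPoly]
  rw [Polynomial.X_dvd_iff, Polynomial.coeff_zero_eq_eval_zero, eval_zero_deformation, h,
    pIdeal, RingHom.mem_ker]
  exact Polynomial.C_eq_zero

lemma vanishesToOrderSeven_of_mem_symbPow {c : ℕ × ℕ → K}
    (hc : latticePoly c ∈ symbPow (pIdeal K 5 11 18) 7) : VanishesToOrderSeven c := by
  intro a b hab
  have hdvd : Polynomial.X ^ 7 ∣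
      (deformation (.C .X : Polynomial (Polynomial K)) .X).toRingHom (latticePoly c) :=
    X_pow_dvd_of_mem_symbPow _ (fun _ => X_dvd_deformation_iff) hc
  have hsum := sum_choose_of_X_pow_dvd (Polynomial.C_ne_zero.2 Polynomial.X_ne_zero) hdvd hab
  have h := congrArg (fun q => (q.coeff b).coeff 0) hsum
  have hterm (p : ℕ × ℕ) : ((algebraMap K (Polynomial (Polynomial K)) (c p) *
      ∑ q ∈ Finset.HasAntidiagonal.antidiagonal (a + b),
        ((p.1.choose q.1 : Polynomial (Polynomial K)) *
          (p.2.choose q.2 * .X ^ q.2))).coeff b).coeff 0 =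
      c p * (p.1.choose a * p.2.choose b) := by
    rw [Polynomial.algebraMap_apply, Polynomial.algebraMap_apply, Algebra.algebraMap_self_apply,
      Polynomial.coeff_C_mul, Polynomial.coeff_C_mul, Polynomial.finsetSum_coeff,
      Finset.sum_eq_single (a, b)]
    · simp [← mul_assoc, ← Nat.cast_mul, Polynomial.coeff_natCast_mul]
    · rintro ⟨i, j⟩ hij hne
      have hj : b ≠ j := by
        rintro rfl
        simp_all
      simp [← mul_assoc, ← Nat.cast_mul, Polynomial.coeff_natCast_mul, Polynomial.coeff_X_pow, hj]
    · simp
  simpa only [Polynomial.finsetSum_coeff, hterm, Polynomial.coeff_zero] using h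

end SymbolicPower

section Curve

/-- The coefficients of the negative curve. -/
def curveCoeff : ℕ × ℕ → ℤ
  | (0, 0) => -1
  | (1, 1) => 11
  | (1, 2) => -4
  | (2, 1) => -4
  | (2, 2) => -43
  | (2, 3) => 32
  | (2, 4) => -6
  | (3, 1) => -1
  | (3, 2) => 37
  | (3, 3) => 43
  | (3, 4) => -66
  | (3, 5) => 25
  | (3, 6) => -3
  | (4, 2) => -2
  | (4, 3) => -98
  | (4, 4) => 94
  | (4, 5) => -40
  | (4, 6) => 16
  | (4, 7) => -6
  | (4, 8) => 1
  | (5, 2) => -3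
  | (5, 3) => 48
  | (5, 4) => -26
  | (5, 5) => 1
  | (5, 6) => 1
  | (6, 2) => 1
  | (6, 3) => -12
  | (6, 4) => 4
  | (7, 3) => 1
  | _ => 0

/-- The entry `(a, b)` is the coefficient of `(m.choose a) * (n.choose b)` in the polynomial of
degree at most `6` that takes the value `1` at `p` and `0` at the other lattice points
apart from `(7, 3)`. -/
def interpolant : ℕ × ℕ → List (List ℤ)
  | (0, 0) => [[1], [-1], [1], [-1], [1], [-1], [1]]
  | (1, 1) => [[0, -6], [2, 5], [-4, -4], [6, 3], [-8, -2], [10, 1], [-12]]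
  | (1, 2) => [[0, 6], [-1, -5], [2, 4], [-3, -3], [4, 2], [-5, -1], [6]]
  | (2, 1) => [[0, -6, 20, -10], [8, -2, -12, 6], [-12, 7, 6, -3], [12, -9, -2, 1], [-8, 8], [0,
      -4], [8]]
  | (2, 2) => [[0, 33, -45, 30], [-19, -14, 26, -18], [32, 1, -12, 9], [-39, 6, 3, -3], [40, -7,
      1], [-35, 2], [36]]
  | (2, 3) => [[0, -33, 30, -30], [14, 19, -16, 18], [-24, -9, 6, -9], [30, 3, 0, 3], [-32, -1,
      -2], [30, 3], [-36]]
  | (2, 4) => [[0, 6, -5, 10], [-3, -3, 2, -6], [5, 1, 0, 3], [-6, 0, -1, -1], [6, 0, 1], [-5,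
      -1], [7]]
  | (3, 1) => [[0, 10, -24, 8, 8, -4], [-4, -6, 20, -9, -2, 1], [12, -2, -12, 6], [-18, 9, 4,
      -2], [16, -10], [-6, 5], [-4]]
  | (3, 2) => [[0, -12, 10, -10, -30, 20], [-8, 20, -18, 21, 6, -5], [-1, -11, 9, -15, 1], [12,
      0, 3, 4], [-10, -2, -4], [10, 7], [-34]]
  | (3, 3) => [[0, -48, 80, -20, 40, -40], [40, 8, -40, -8, -4, 10], [-52, 4, 28, 8, -4], [56,
      -8, -24, 1], [-72, 24, 8], [60, -22], [-16]]
  | (3, 4) => [[0, 76, -100, 40, -20, 40], [-42, -34, 58, -12, -4, -10], [62, 14, -38, 6, 6],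
      [-75, -1, 25, -7], [96, -20, -4], [-80, 14], [52]]
  | (3, 5) => [[0, -30, 40, -20, 0, -20], [16, 14, -24, 9, 6, 5], [-24, -6, 16, -6, -4], [30, 0,
      -10, 5], [-40, 10], [30, -5], [-20]]
  | (3, 6) => [[0, 4, -6, 2, 2, 4], [-2, -2, 4, -1, -2, -1], [3, 1, -3, 1, 1], [-4, 0, 2, -1],
      [6, -2], [-4, 1], [2]]
  | (4, 2) => [[0, -49, 107, -18, -26, 5, 1], [19, 30, -88, 21, 11, -2], [-44, -5, 63, -18, -2],
      [76, -27, -31, 8], [-88, 46, 6], [50, -32], [24]]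
  | (4, 3) => [[0, 171, -334, 62, 120, -27, -6], [-50, -121, 284, -82, -50, 11], [128, 43, -206,
      74, 8], [-240, 69, 94, -32], [280, -130, -12], [-168, 80], [8]]
  | (4, 4) => [[0, -219, 440, -85, -225, 60, 15], [49, 170, -391, 132, 92, -25], [-151, -68,
      289, -126, -12], [321, -102, -119, 52], [-364, 180, 6], [190, -96], [2]]
  | (4, 5) => [[0, 155, -350, 65, 220, -70, -20], [-28, -127, 322, -117, -88, 30], [108, 47,
      -242, 117, 8], [-260, 105, 90, -45], [280, -160], [-120, 80], [-40]]
  | (4, 6) => [[0, -81, 190, -35, -120, 45, 15], [15, 66, -175, 64, 47, -20], [-58, -23, 132,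
      -65, -2], [144, -63, -46, 23], [-148, 88], [60, -44], [28]]
  | (4, 7) => [[0, 27, -62, 13, 36, -15, -6], [-6, -21, 56, -21, -14, 7], [20, 7, -42, 21],
      [-48, 21, 14, -7], [48, -28], [-20, 14], [-8]]
  | (4, 8) => [[0, -4, 9, -2, -5, 2, 1], [1, 3, -8, 3, 2, -1], [-3, -1, 6, -3], [7, -3, -2, 1],
      [-7, 4], [3, -2], [1]]
  | (5, 2) => [[0, 18, -34, 2, 6], [-6, -12, 28, -3, -3], [13, 5, -21, 3, 1], [-21, 3, 13, -2],
      [30, -12, -4], [-25, 12], [-4]]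
  | (5, 3) => [[0, -48, 80, -4, -24], [12, 36, -68, 9, 12], [-28, -20, 52, -10, -4], [48, 0,
      -32, 7], [-72, 24, 8], [60, -22], [-16]]
  | (5, 4) => [[0, 36, -60, 0, 36], [-5, -31, 55, -9, -18], [16, 20, -44, 12, 6], [-33, -3, 27,
      -9], [56, -20, -4], [-40, 14], [12]]
  | (5, 5) => [[0, -6, 16, 4, -24], [-2, 8, -18, 3, 12], [0, -6, 16, -6, -4], [6, 0, -10, 5],
      [-16, 10], [6, -5], [4]]
  | (5, 6) => [[0, 0, -2, -2, 6], [1, -1, 3, 0, -3], [-1, 1, -3, 1, 1], [0, 0, 2, -1], [2, -2],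
      [0, 1], [-2]]
  | (6, 2) => [[0, -3, 5], [1, 2, -4], [-2, -1, 3], [3, 0, -2], [-4, 1, 1], [5, -2]]
  | (6, 3) => [[0, 7, -10], [-2, -5, 8], [4, 3, -6], [-6, -1, 4], [8, -1, -2], [-10, 3], [4]]
  | (6, 4) => [[0, -4, 5], [1, 3, -4], [-2, -2, 3], [3, 1, -2], [-4, 0, 1], [5, -1], [-3]]
  | _ => []

lemma sum_curveCoeff_mul_choose : ∀ a ∈ Finset.range 7, ∀ b ∈ Finset.range 7, a + b < 7 →
    ∑ p ∈ latticePoints, curveCoeff p * (p.1.choose a * p.2.choose b) = 0 := by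
  decide +kernel

lemma sum_interpolant : ∀ p ∈ latticePoints, ∀ q ∈ latticePoints,
    ∑ a ∈ Finset.range 7, ∑ b ∈ Finset.range (7 - a),
      ((interpolant p).getD a []).getD b 0 * (q.1.choose a * q.2.choose b) =
        (if q = p then 1 else 0) - curveCoeff p * (if q = (7, 3) then 1 else 0) := by
  decide +kernel

variable {K : Type*} [Field K]

lemma vanishesToOrderSeven_curveCoeff :
    VanishesToOrderSeven (K := K) fun p => (curveCoeff p : K) := by
  intro a b hab
  have h := congrArg (Int.cast : ℤ → K) (sum_curveCoeff_mul_choose a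
    (Finset.mem_range.2 (by omega)) b (Finset.mem_range.2 (by omega)) hab)
  push_cast at h
  exact h

lemma VanishesToOrderSeven.eq_curveCoeff_mul {c : ℕ × ℕ → K} (hc : VanishesToOrderSeven c)
    {p : ℕ × ℕ} (hp : p ∈ latticePoints) : c p = c (7, 3) * curveCoeff p := by
  have hstar : (7, 3) ∈ latticePoints := by decide
  have hzero : ∑ q ∈ latticePoints, c q *
      ((∑ a ∈ Finset.range 7, ∑ b ∈ Finset.range (7 - a),
        ((interpolant p).getD a []).getD b 0 * (q.1.choose a * q.2.choose b) : ℤ) : K) = 0 := by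
    push_cast
    simp only [Finset.mul_sum]
    rw [Finset.sum_comm]
    refine Finset.sum_eq_zero fun a _ => ?_
    rw [Finset.sum_comm]
    refine Finset.sum_eq_zero fun b hb => ?_
    rw [Finset.mem_range] at hb
    rw [Finset.sum_congr rfl fun q _ => mul_left_comm (c q) _ _, ← Finset.mul_sum,
      hc a b (by omega), mul_zero]
  rw [Finset.sum_congr rfl fun q hq => by rw [sum_interpolant p hp q hq]] at hzero
  push_cast at hzero
  simp only [mul_sub, Finset.sum_sub_distrib, mul_ite, mul_one, mul_zero, Finset.sum_ite_eq',
    hp, hstar, if_true] at hzero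
  exact sub_eq_zero.1 hzero

/-- The negative curve of degree `220`. -/
noncomputable def negativeCurve (K : Type*) [Field K] : MvPolynomial (Fin 3) K :=
  latticePoly fun p => (curveCoeff p : K)

lemma gpiece_eq_span_negativeCurve :
    gpiece K 5 11 18 (symbPow (pIdeal K 5 11 18) 7) 220 =
      Submodule.span K {negativeCurve K} := by
  refine le_antisymm (fun f hf => ?_) ?_
  · obtain ⟨hmem, hhom⟩ := Submodule.mem_inf.1 hf
    have hf' := eq_latticePoly ((mem_weightedHomogeneousSubmodule _ _ _ _).1 hhom)
    have hmem' : f ∈ symbPow (pIdeal K 5 11 18) 7 := hmem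
    rw [hf'] at hmem'
    have hc := vanishesToOrderSeven_of_mem_symbPow hmem'
    refine Submodule.mem_span_singleton.2 ⟨coeff (latticeExp (7, 3)) f, ?_⟩
    conv_rhs => rw [hf']
    rw [negativeCurve, latticePoly, latticePoly, Finset.smul_sum]
    refine Finset.sum_congr rfl fun p hp => ?_
    rw [smul_monomial, smul_eq_mul, hc.eq_curveCoeff_mul hp]
  · rw [Submodule.span_singleton_le_iff_mem]
    exact Submodule.mem_inf.2 ⟨latticePoly_mem_symbPow vanishesToOrderSeven_curveCoeff,
      (mem_weightedHomogeneousSubmodule _ _ _ _).2 (latticePoly_isWeightedHomogeneous _)⟩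

lemma coeff_negativeCurve_ne_zero :
    coeff (Finsupp.single 0 44) (negativeCurve K) ≠ 0 := by
  have h : latticeExp (0, 0) = Finsupp.single 0 44 := by
    ext i
    fin_cases i <;> simp [latticeExp]
  rw [← h, negativeCurve, coeff_latticePoly _ (by decide)]
  simp [curveCoeff]

end Curve

section Homogeneous

variable {σ R : Type*} [CommRing R]

/-- The homomorphism rescaling each variable by a power of a new variable. -/
noncomputable def weightedScaling (w : σ → ℕ) :
    MvPolynomial σ R →ₐ[R] Polynomial (MvPolynomial σ R) :=
  aeval fun i => .C (X i) * .X ^ w i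

lemma weightedScaling_monomial (w : σ → ℕ) (d : σ →₀ ℕ) (r : R) :
    weightedScaling w (monomial d r) =
      Polynomial.monomial (Finsupp.weight w d) (monomial d r) := by
  have h : (d.prod fun i k => (Polynomial.C (X i : MvPolynomial σ R) * Polynomial.X ^ w i) ^ k) =
      Polynomial.C (d.prod fun i k => X i ^ k) * Polynomial.X ^ Finsupp.weight w d := by
    simp only [Finsupp.prod, Finsupp.weight_apply, Finsupp.sum, mul_pow, Finset.prod_mul_distrib,
      ← pow_mul, Finset.prod_pow_eq_pow_sum, map_prod, map_pow, smul_eq_mul]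
    simp only [mul_comm (w _)]
  rw [weightedScaling, aeval_monomial, h, ← Polynomial.C_mul_X_pow_eq_monomial, monomial_eq,
    Polynomial.algebraMap_apply, algebraMap_eq, map_mul, mul_assoc]

lemma coeff_weightedScaling (w : σ → ℕ) (f : MvPolynomial σ R) (n : ℕ) (d : σ →₀ ℕ) :
    coeff d ((weightedScaling w f).coeff n) = if Finsupp.weight w d = n then coeff d f else 0 := by
  classical
  induction f using MvPolynomial.induction_on' with
  | monomial e r =>
    rw [weightedScaling_monomial, Polynomial.coeff_monomial]
    by_cases hed : e = d
    · subst hed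
      split_ifs <;> simp
    · split_ifs <;> simp [coeff_monomial, hed]
  | add p q hp hq =>
    rw [map_add, Polynomial.coeff_add, coeff_add, coeff_add, hp, hq]
    split_ifs <;> simp

lemma isWeightedHomogeneous_iff_weightedScaling (w : σ → ℕ) (f : MvPolynomial σ R) (n : ℕ) :
    IsWeightedHomogeneous w f n ↔ weightedScaling w f = Polynomial.monomial n f := by
  constructor
  · intro h
    ext m d
    rw [coeff_weightedScaling, Polynomial.coeff_monomial]
    split_ifs with h1 h2 h2
    · rfl
    · simpa using h.coeff_eq_zero d (by omega)
    · simpa using (h.coeff_eq_zero d (by omega)).symm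
    · rfl
  · intro h d hd
    by_contra hne
    have := coeff_weightedScaling w f (Finsupp.weight w d) d
    rw [h, Polynomial.coeff_monomial, if_neg (Ne.symm hne), if_pos rfl, coeff_zero] at this
    exact hd this.symm

lemma isWeightedHomogeneous_of_natDegree_le {w : σ → ℕ} {f : MvPolynomial σ R}
    (h : (weightedScaling w f).natDegree ≤ (weightedScaling w f).natTrailingDegree) :
    IsWeightedHomogeneous w f (weightedScaling w f).natDegree := by
  intro d hd
  have hcoeff : (weightedScaling w f).coeff (Finsupp.weight w d) ≠ 0 := fun h0 => by
    have := coeff_weightedScaling w f (Finsupp.weight w d) d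
    rw [h0, if_pos rfl, coeff_zero] at this
    exact hd this.symm
  have h1 := Polynomial.le_natDegree_of_ne_zero hcoeff
  have h2 := Polynomial.natTrailingDegree_le_of_ne_zero hcoeff
  omega

lemma IsWeightedHomogeneous.exists_of_mul [IsDomain R] {w : σ → ℕ} {f g : MvPolynomial σ R} {n : ℕ}
    (hfg : f * g ≠ 0) (h : IsWeightedHomogeneous w (f * g) n) :
    ∃ a b, a + b = n ∧ IsWeightedHomogeneous w f a ∧ IsWeightedHomogeneous w g b := by
  have hmul : weightedScaling w f * weightedScaling w g = Polynomial.monomial n (f * g) := by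
    rw [← map_mul, (isWeightedHomogeneous_iff_weightedScaling w _ n).1 h]
  have hne : weightedScaling w f * weightedScaling w g ≠ 0 := by
    rwa [hmul, Ne, Polynomial.monomial_eq_zero_iff]
  have hdeg := Polynomial.natDegree_mul (left_ne_zero_of_mul hne) (right_ne_zero_of_mul hne)
  have htrail := Polynomial.natTrailingDegree_mul (left_ne_zero_of_mul hne)
    (right_ne_zero_of_mul hne)
  rw [hmul, Polynomial.natDegree_monomial_eq _ hfg] at hdeg
  rw [hmul, Polynomial.natTrailingDegree_monomial hfg] at htrail
  have hf := (weightedScaling w f).natTrailingDegree_le_natDegree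
  have hg := (weightedScaling w g).natTrailingDegree_le_natDegree
  exact ⟨_, _, hdeg.symm, isWeightedHomogeneous_of_natDegree_le (by omega),
    isWeightedHomogeneous_of_natDegree_le (by omega)⟩

end Homogeneous

section Irreducible

variable {K : Type*} [Field K]

lemma exists_coeff_ne_zero_of_aeval {v : Fin 3 → Polynomial K} {f : MvPolynomial (Fin 3) K} {n : ℕ}
    (h : (aeval v f).coeff n ≠ 0) :
    ∃ d, coeff d f ≠ 0 ∧ (v 0 ^ d 0 * v 1 ^ d 1 * v 2 ^ d 2).coeff n ≠ 0 := by
  rw [aeval_def, eval₂_eq', Polynomial.finsetSum_coeff] at h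
  obtain ⟨d, hd, hne⟩ := Finset.exists_ne_zero_of_sum_ne_zero h
  refine ⟨d, mem_support_iff.1 hd, fun h0 => hne ?_⟩
  rw [Fin.prod_univ_three, Polynomial.algebraMap_apply, Polynomial.coeff_C_mul, h0, mul_zero]

lemma five_dvd_of_aeval_ne_zero {f : MvPolynomial (Fin 3) K} {n : ℕ}
    (hf : IsWeightedHomogeneous (wt 5 11 18) f n)
    (h : aeval ![(.X : Polynomial K), 0, 0] f ≠ 0) : 5 ∣ n := by
  obtain ⟨k, hk⟩ : ∃ k, (aeval ![(.X : Polynomial K), 0, 0] f).coeff k ≠ 0 := by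
    contrapose! h
    exact Polynomial.ext h
  obtain ⟨d, hd, hne⟩ := exists_coeff_ne_zero_of_aeval hk
  have hw := hf hd
  rw [weight_wt] at hw
  have h1 : d 1 = 0 := by by_contra h1; simp [h1] at hne
  have h2 : d 2 = 0 := by by_contra h2; simp [h2] at hne
  omega

lemma eleven_dvd_of_aeval_ne_zero {f : MvPolynomial (Fin 3) K} {n : ℕ}
    (hf : IsWeightedHomogeneous (wt 5 11 18) f n)
    (h : aeval ![0, (.X : Polynomial K), 0] f ≠ 0) : 11 ∣ n := by
  obtain ⟨k, hk⟩ : ∃ k, (aeval ![0, (.X : Polynomial K), 0] f).coeff k ≠ 0 := by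
    contrapose! h
    exact Polynomial.ext h
  obtain ⟨d, hd, hne⟩ := exists_coeff_ne_zero_of_aeval hk
  have hw := hf hd
  rw [weight_wt] at hw
  have h0 : d 0 = 0 := by by_contra h0; simp [h0] at hne
  have h2 : d 2 = 0 := by by_contra h2; simp [h2] at hne
  omega

lemma exists_eq_trailing_degree {f : MvPolynomial (Fin 3) K} {n : ℕ}
    (hf : IsWeightedHomogeneous (wt 5 11 18) f n)
    (h : aeval ![0, (.X : Polynomial K), 1] f ≠ 0) :
    ∃ k, n = 11 * (aeval ![0, (.X : Polynomial K), 1] f).natTrailingDegree + 18 * k := by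
  obtain ⟨d, hd, hne⟩ := exists_coeff_ne_zero_of_aeval
    (mt Polynomial.trailingCoeff_eq_zero.1 h)
  have hw := hf hd
  rw [weight_wt] at hw
  have h0 : d 0 = 0 := by by_contra h0; simp [h0] at hne
  have h1 : (aeval ![0, (.X : Polynomial K), 1] f).natTrailingDegree = d 1 := by
    by_contra h1
    simp [h0, Polynomial.coeff_X_pow, h1] at hne
  exact ⟨d 2, by omega⟩

lemma isUnit_of_isWeightedHomogeneous_zero {f : MvPolynomial (Fin 3) K} (hf0 : f ≠ 0)
    (hf : IsWeightedHomogeneous (wt 5 11 18) f 0) : IsUnit f := by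
  have h : f = C (coeff 0 f) := by
    ext d
    rw [coeff_C]
    split_ifs with hd
    · rw [hd]
    · by_contra hne
      have hw := hf hne
      rw [weight_wt] at hw
      refine hd (Finsupp.ext fun i => ?_)
      fin_cases i <;> simp <;> omega
  rw [h]
  refine (isUnit_iff_ne_zero.2 fun h0 => hf0 ?_).map C
  rw [h, h0, C_0]

lemma sum_latticePoints {A : Type*} [AddCommMonoid A] (F : ℕ × ℕ → A) :
    ∑ p ∈ latticePoints, F p =
      F (0, 0) + F (1, 1) + F (1, 2) + F (2, 1) + F (2, 2) + F (2, 3) + F (2, 4) + F (3, 1)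
      + F (3, 2) + F (3, 3) + F (3, 4) + F (3, 5) + F (3, 6) + F (4, 2) + F (4, 3) + F (4, 4)
      + F (4, 5) + F (4, 6) + F (4, 7) + F (4, 8) + F (5, 2) + F (5, 3) + F (5, 4) + F (5, 5)
      + F (5, 6) + F (6, 2) + F (6, 3) + F (6, 4) + F (7, 3) := by
  simp only [latticePoints, Finset.sum_filter, Finset.sum_product, Finset.sum_range_succ,
    Finset.sum_range_zero]
  norm_num [add_assoc]

lemma aeval_negativeCurve_x_axis :
    aeval ![(.X : Polynomial K), 0, 0] (negativeCurve K) = -.X ^ 44 := by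
  simp [negativeCurve, aeval_latticePoly, sum_latticePoints, curveCoeff]

lemma aeval_negativeCurve_y_axis :
    aeval ![0, (.X : Polynomial K), 0] (negativeCurve K) = .X ^ 20 := by
  simp [negativeCurve, aeval_latticePoly, sum_latticePoints, curveCoeff]

lemma aeval_negativeCurve_yz_edge :
    aeval ![0, (.X : Polynomial K), 1] (negativeCurve K) = .X ^ 2 * (.X ^ 18 + 1) := by
  simp [negativeCurve, aeval_latticePoly, sum_latticePoints, curveCoeff]
  ring

theorem irreducible_negativeCurve : Irreducible (negativeCurve K) := by
  have hX20 : (Polynomial.X ^ 20 : Polynomial K) ≠ 0 := pow_ne_zero _ Polynomial.X_ne_zero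
  have hX44 : (-Polynomial.X ^ 44 : Polynomial K) ≠ 0 :=
    neg_ne_zero.2 (pow_ne_zero _ Polynomial.X_ne_zero)
  have hone : (Polynomial.X ^ 18 + 1 : Polynomial K).coeff 0 = 1 := by simp
  have hedge : (Polynomial.X ^ 18 + 1 : Polynomial K) ≠ 0 := fun h => by simp [h] at hone
  have htrail : (Polynomial.X ^ 2 * (Polynomial.X ^ 18 + 1) : Polynomial K).natTrailingDegree =
      2 := by
    rw [mul_comm, Polynomial.natTrailingDegree_mul_X_pow hedge,
      Nat.eq_zero_of_le_zero (Polynomial.natTrailingDegree_le_of_ne_zero (n := 0)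
        (by rw [hone]; exact one_ne_zero))]
  refine ⟨fun hunit => ?_, fun f g hfg => ?_⟩
  · have h := hunit.map (aeval ![0, (.X : Polynomial K), 0])
    rw [aeval_negativeCurve_y_axis, isUnit_pow_iff (by norm_num)] at h
    exact Polynomial.not_isUnit_X h
  · have hne : f * g ≠ 0 := by
      rintro h
      rw [← hfg] at h
      rw [← aeval_negativeCurve_y_axis, h, map_zero] at hX20
      exact hX20 rfl
    obtain ⟨a, b, hab, hf, hg⟩ := IsWeightedHomogeneous.exists_of_mul (n := 220) hne
      (by rw [← hfg]; exact latticePoly_isWeightedHomogeneous _)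
    rw [← aeval_negativeCurve_x_axis, hfg, map_mul] at hX44
    rw [← aeval_negativeCurve_y_axis, hfg, map_mul] at hX20
    have hyz : (Polynomial.X ^ 2 * (Polynomial.X ^ 18 + 1) : Polynomial K) ≠ 0 :=
      mul_ne_zero (pow_ne_zero _ Polynomial.X_ne_zero) hedge
    rw [← aeval_negativeCurve_yz_edge, hfg, map_mul] at hyz htrail
    rw [Polynomial.natTrailingDegree_mul (left_ne_zero_of_mul hyz)
      (right_ne_zero_of_mul hyz)] at htrail
    have hf5 := five_dvd_of_aeval_ne_zero hf (left_ne_zero_of_mul hX44)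
    have hg5 := five_dvd_of_aeval_ne_zero hg (right_ne_zero_of_mul hX44)
    have hf11 := eleven_dvd_of_aeval_ne_zero hf (left_ne_zero_of_mul hX20)
    have hg11 := eleven_dvd_of_aeval_ne_zero hg (right_ne_zero_of_mul hX20)
    obtain ⟨k, hk⟩ := exists_eq_trailing_degree hf (left_ne_zero_of_mul hyz)
    obtain ⟨l, hl⟩ := exists_eq_trailing_degree hg (right_ne_zero_of_mul hyz)
    have hzero : a = 0 ∨ b = 0 := by omega
    rcases hzero with rfl | rfl
    · exact .inl (isUnit_of_isWeightedHomogeneous_zero (left_ne_zero_of_mul hne) hf)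
    · exact .inr (isUnit_of_isWeightedHomogeneous_zero (right_ne_zero_of_mul hne) hg)

end Irreducible

/-- for char-`0` `K`, the space `[𝔭_K(5,11,18)^{(7)}]_{220}` is
one-dimensional, spanned by an irreducible `g1` whose coefficient of `x^{44}`
is nonzero; `g1` is a negative curve (`220² < 5·11·18·7²`). -/
theorem statement13 (K : Type*) [Field K] [CharZero K] :
    ∃ g1 : MvPolynomial (Fin 3) K,
      Irreducible g1 ∧
      MvPolynomial.coeff (Finsupp.single (0 : Fin 3) 44) g1 ≠ 0 ∧
      gpiece K 5 11 18 (symbPow (pIdeal K 5 11 18) 7) 220 =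
        Submodule.span K {g1} ∧
      220 ^ 2 < 5 * 11 * 18 * 7 ^ 2 := by
  exact ⟨negativeCurve K, irreducible_negativeCurve, coeff_negativeCurve_ne_zero,
    gpiece_eq_span_negativeCurve, by norm_num⟩
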